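/- arXiv:2401.14383 — 4 statements merged into one kernel-verified Lean document; each statement's English description precedes it below -/
import Mathlib

section
/- For every natural number n, C_n = 4^n · ∫_{-1}^{1} x^{2n} · (2/π)·√(1−x²) dx; that is, the 2n-th moment of the semicircle distribution equals C_n / 4^n. -/
lemma aux_rec (n : ℕ) : (∫ x in (-(Real.pi/2))..(Real.pi/2), Real.sin x ^ (2 * (n+1))) =
    (2 * n + 1) / (2 * n + 2) * ∫ x in (-(Real.pi/2))..(Real.pi/2), Real.sin x ^ (2 * n) := by
  have h := integral_sin_pow (a := -(Real.pi/2)) (b := Real.pi/2) (2 * n)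
  rw [show 2 * (n + 1) = 2 * n + 2 by ring, h]
  simp

lemma aux_val (n : ℕ) : (∫ x in (-(Real.pi/2))..(Real.pi/2), Real.sin x ^ (2 * n)) =
    Real.pi * n.centralBinom / 4 ^ n := by
  induction n with
  | zero => simp
  | succ k ih =>
    rw [aux_rec, ih]
    have h : ((k : ℝ) + 1) * (k+1).centralBinom = 2 * (2 * k + 1) * k.centralBinom := by
      exact_mod_cast Nat.succ_mul_centralBinom_succ k
    have h2 : ((k+1).centralBinom : ℝ) = 2 * (2 * k + 1) * k.centralBinom / (k + 1) := by
      rw [← h]; field_simp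
    rw [h2]
    field_simp
    ring

lemma aux_subst (n : ℕ) : (∫ x in (-1 : ℝ)..1, x ^ (2 * n) * ((2 / Real.pi) * Real.sqrt (1 - x ^ 2)))
    = (2 / Real.pi) * ∫ x in (-(Real.pi/2))..(Real.pi/2),
      (Real.sin x ^ (2 * n) - Real.sin x ^ (2 * (n+1))) := by
  have h := intervalIntegral.integral_comp_mul_deriv (a := -(Real.pi/2)) (b := Real.pi/2)
    (f := Real.sin) (f' := Real.cos)
    (g := fun x => x ^ (2 * n) * ((2 / Real.pi) * Real.sqrt (1 - x ^ 2)))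
    (fun x _ => Real.hasDerivAt_sin x) Real.continuous_cos.continuousOn (by fun_prop)
  rw [Real.sin_neg, Real.sin_pi_div_two] at h
  rw [← h, ← intervalIntegral.integral_const_mul]
  apply intervalIntegral.integral_congr
  intro x hx
  rw [Set.uIcc_of_le (by linarith [Real.pi_pos])] at hx
  have hc := Real.cos_nonneg_of_mem_Icc hx
  have hs : Real.sqrt (1 - Real.sin x ^ 2) = Real.cos x := by
    rw [← Real.cos_sq', Real.sqrt_sq hc]
  simp only [Function.comp, hs]
  have := Real.cos_sq' x
  linear_combination (Real.sin x ^ (2 * n) * (2 / Real.pi)) * this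

/-- For every natural number `n`, the `n`-th Catalan number equals
`4^n` times the `2n`-th moment of the semicircle law `μ_sc(x) = (2/π)√(1−x²)` on `[−1,1]`. -/
theorem catalan_eq_semicircle_moment (n : ℕ) :
    (catalan n : ℝ) =
      4 ^ n * ∫ x in (-1 : ℝ)..1, x ^ (2 * n) * ((2 / Real.pi) * Real.sqrt (1 - x ^ 2)) := by
  have hc : ((n : ℝ) + 1) * catalan n = n.centralBinom := by
    exact_mod_cast succ_mul_catalan_eq_centralBinom n
  rw [aux_subst, intervalIntegral.integral_sub
    (Continuous.intervalIntegrable (by fun_prop) _ _)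
    (Continuous.intervalIntegrable (by fun_prop) _ _), aux_rec, aux_val, ← hc]
  have := Real.pi_ne_zero
  field_simp
  ring
end

section
/- Let A and B be real symmetric n×n matrices and let p = 2^k for an integer k ≥ 0. Then (Tr(A^{p−1} B))^p ≤ (Tr(A^p))^{p−1} · Tr(B^p). -/
open Matrix

lemma jensen_dyadic {n : ℕ} (w : Fin n → ℝ) (hw : ∀ i, 0 ≤ w i) (k : ℕ) :
    ∀ z : Fin n → ℝ, (∑ i, w i * z i) ^ (2 ^ k)
      ≤ (∑ i, w i) ^ (2 ^ k - 1) * ∑ i, w i * z i ^ (2 ^ k) := by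
  induction k with
  | zero => intro z; simp
  | succ k ih =>
    intro z
    have hW : 0 ≤ ∑ i, w i := Finset.sum_nonneg fun i _ => hw i
    have h1 : (∑ i, w i * z i) ^ 2 ≤ (∑ i, w i) * ∑ i, w i * z i ^ 2 :=
      Finset.sum_sq_le_sum_mul_sum_of_sq_eq_mul _ (fun i _ => hw i)
        (fun i _ => mul_nonneg (hw i) (sq_nonneg _)) (fun i _ => by ring)
    have h2 := ih (fun i => z i ^ 2)
    have e : 2 ^ (k + 1) - 1 = 2 ^ k + (2 ^ k - 1) := by
      have := Nat.one_le_two_pow (n := k)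
      omega
    calc (∑ i, w i * z i) ^ (2 ^ (k + 1)) = ((∑ i, w i * z i) ^ 2) ^ (2 ^ k) := by
          rw [← pow_mul, pow_succ' 2 k]
      _ ≤ ((∑ i, w i) * ∑ i, w i * z i ^ 2) ^ (2 ^ k) :=
          pow_le_pow_left₀ (sq_nonneg _) h1 _
      _ = (∑ i, w i) ^ (2 ^ k) * (∑ i, w i * z i ^ 2) ^ (2 ^ k) := mul_pow _ _ _
      _ ≤ (∑ i, w i) ^ (2 ^ k) *
          ((∑ i, w i) ^ (2 ^ k - 1) * ∑ i, w i * (z i ^ 2) ^ (2 ^ k)) :=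
          mul_le_mul_of_nonneg_left h2 (pow_nonneg hW _)
      _ = _ := by
          rw [e, pow_add, mul_assoc]
          simp only [← pow_mul, pow_succ' 2 k]

lemma diag_pow_le {n : ℕ} (k : ℕ) : ∀ (B : Matrix (Fin n) (Fin n) ℝ), B.IsSymm → ∀ i,
    B i i ^ (2 ^ k) ≤ (B ^ (2 ^ k)) i i := by
  induction k with
  | zero => intro B _ i; simp
  | succ k ih =>
    intro B hB i
    have h1 : B i i ^ 2 ≤ (B ^ 2) i i := by
      rw [sq B, Matrix.mul_apply]
      have : ∀ j, B i j * B j i = B i j ^ 2 := fun j => by rw [hB.apply i j]; ring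
      simp only [this]
      exact Finset.single_le_sum (f := fun j => B i j ^ 2) (fun j _ => sq_nonneg _)
        (Finset.mem_univ i)
    rw [pow_succ' 2 k, pow_mul, pow_mul]
    exact (pow_le_pow_left₀ (sq_nonneg _) h1 _).trans (ih _ (hB.pow 2) i)

/-- Trace (Schatten-norm) Hölder inequality for dyadic exponents: for real symmetric
`n×n` matrices `A, B` and `p = 2^k`, `(Tr(A^{p−1} B))^p ≤ (Tr(A^p))^{p−1} · Tr(B^p)`. -/
theorem trace_holder_dyadic {n : ℕ} (A B : Matrix (Fin n) (Fin n) ℝ)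
    (hA : A.IsSymm) (hB : B.IsSymm) (k : ℕ) :
    (A ^ (2 ^ k - 1) * B).trace ^ (2 ^ k)
      ≤ (A ^ (2 ^ k)).trace ^ (2 ^ k - 1) * (B ^ (2 ^ k)).trace := by
  rcases Nat.eq_zero_or_pos k with rfl | hk
  · simp
  have hp : Even (2 ^ k) := (Nat.even_pow' hk.ne').2 even_two
  have hp2 : 2 ≤ 2 ^ k := Nat.le_self_pow hk.ne' 2
  obtain ⟨U, V, d, hVU, hUV, hV, hAd⟩ : ∃ (U V : Matrix (Fin n) (Fin n) ℝ) (d : Fin n → ℝ),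
      V * U = 1 ∧ U * V = 1 ∧ V = Uᵀ ∧ A = U * diagonal d * V := by
    have hH : A.IsHermitian := by
      rw [Matrix.IsHermitian, conjTranspose_eq_transpose_of_trivial]; exact hA
    refine ⟨hH.eigenvectorUnitary, star (hH.eigenvectorUnitary : Matrix (Fin n) (Fin n) ℝ),
      hH.eigenvalues, by simp, by simp, ?_, ?_⟩
    · rw [star_eq_conjTranspose, conjTranspose_eq_transpose_of_trivial]
    · simpa [Unitary.conjStarAlgAut_apply, Function.comp_def] using hH.spectral_theorem
  have conj_pow : ∀ (P Q M : Matrix (Fin n) (Fin n) ℝ), Q * P = 1 → P * Q = 1 → ∀ m : ℕ,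
      (P * M * Q) ^ m = P * M ^ m * Q := by
    intro P Q M h h' m
    induction m with
    | zero => simp [h']
    | succ m ih =>
      rw [pow_succ, ih, pow_succ]
      calc P * M ^ m * Q * (P * M * Q) = P * M ^ m * (Q * P) * M * Q := by
            simp only [mul_assoc]
        _ = _ := by rw [h]; simp only [mul_assoc, one_mul, mul_one]
  set C := V * B * U with hC
  have hCs : C.IsSymm := by
    rw [Matrix.IsSymm, hC, hV]
    simp [Matrix.transpose_mul, hB.eq, mul_assoc]
  have hApow : ∀ m : ℕ, A ^ m = U * diagonal (fun i => d i ^ m) * V := by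
    intro m
    rw [hAd, conj_pow U V _ hVU hUV, diagonal_pow]; rfl
  have t1 : (A ^ (2 ^ k - 1) * B).trace = ∑ i, d i ^ (2 ^ k - 1) * C i i := by
    rw [hApow, mul_assoc, mul_assoc, trace_mul_comm, mul_assoc, ← hC]
    simp [Matrix.trace, diagonal_mul]
  have t2 : (A ^ (2 ^ k)).trace = ∑ i, d i ^ (2 ^ k) := by
    rw [hApow, trace_mul_comm, ← mul_assoc, hVU, one_mul, trace_diagonal]
  have t3 : (B ^ (2 ^ k)).trace = ∑ i, (C ^ (2 ^ k)) i i := by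
    change _ = (C ^ (2 ^ k)).trace
    rw [hC, conj_pow V U _ hUV hVU, trace_mul_comm, ← mul_assoc, hUV, one_mul]
  have hd : ∀ i, 0 ≤ d i ^ (2 ^ k) := fun i => hp.pow_nonneg _
  rw [t1, t2, t3]
  have e1 : ∀ i, d i ^ (2 ^ k - 1) * C i i = d i ^ (2 ^ k) * (C i i / d i) := by
    intro i
    by_cases h : d i = 0
    · have : 2 ^ k - 1 ≠ 0 := by omega
      simp [h, this]
    · obtain ⟨m, hm⟩ : ∃ m, 2 ^ k = m + 1 := ⟨2 ^ k - 1, by omega⟩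
      rw [hm, Nat.add_sub_cancel, pow_succ]
      field_simp
  simp only [e1]
  refine (jensen_dyadic _ hd k _).trans ?_
  refine mul_le_mul_of_nonneg_left (Finset.sum_le_sum fun i _ => ?_)
    (pow_nonneg (Finset.sum_nonneg fun i _ => hd i) _)
  refine le_trans ?_ (diag_pow_le k C hCs i)
  by_cases h : d i = 0
  · have : 2 ^ k ≠ 0 := by omega
    simp only [h, zero_pow this, zero_mul]
    exact hp.pow_nonneg _
  · rw [div_pow, mul_div_cancel₀ _ (pow_ne_zero _ h)]
end

section
/- Let a < b be reals, d ≥ 1 an integer, and M a real symmetric n×n matrix with a·I ⪯ M ⪯ b·I. Let f : ℝ → ℝ satisfy 0 ≤ f(x) ≤ 1 for all x ∈ [a, b] (in particular, this holds for the linear ramp function L_{α,γ}). Define the matrix Bernstein polynomial B^f_d(M) = ∑_{j=0}^{d} f(a + j(b−a)/d) · binom(d, j) · (M − a·I)^j · (b·I − M)^{d−j} / (b−a)^d. Then 0 ⪯ B^f_d(M) ⪯ I; i.e., B^f_d(M) is symmetric positive semidefinite and its operator norm is at most 1. -/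
open Matrix

lemma aux_psd {n : ℕ} (P Q : Matrix (Fin n) (Fin n) ℝ) (hP : P.PosSemidef) (hQ : Q.PosSemidef)
    (hc : Commute P Q) (c : ℝ) (hcpos : 0 < c) (hPQ : P + Q = c • 1) :
    ∀ j k : ℕ, (P ^ j * Q ^ k).PosSemidef
  | 0, 0 => by simpa using Matrix.PosSemidef.one
  | 1, 0 => by simpa using hP
  | 0, 1 => by simpa using hQ
  | 1, 1 => by
      have h1 : (P * Q * P).PosSemidef := by
        have := hQ.mul_mul_conjTranspose_same P
        rwa [hP.1.eq] at this
      have h2 : (Q * P * Q).PosSemidef := by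
        have := hP.mul_mul_conjTranspose_same Q
        rwa [hQ.1.eq] at this
      have h3 : P * Q = c⁻¹ • (P * Q * P + Q * P * Q) := by
        have : P * Q * P + Q * P * Q = c • (P * Q) := by
          rw [← hc.eq, ← mul_add, hPQ, mul_smul_comm, mul_one]
        rw [this, smul_smul, inv_mul_cancel₀ hcpos.ne', one_smul]
      rw [pow_one, pow_one, h3]
      exact (h1.add h2).smul (inv_pos.mpr hcpos).le
  | j + 2, k => by
      have := (aux_psd P Q hP hQ hc c hcpos hPQ j k).mul_mul_conjTranspose_same P
      rw [hP.1.eq] at this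
      have e : P ^ (j + 2) * Q ^ k = P * (P ^ j * Q ^ k) * P := by
        rw [mul_assoc P, mul_assoc (P ^ j), ← (hc.pow_right k).eq, pow_succ, pow_succ']
        simp only [mul_assoc]
      rwa [e]
  | j, k + 2 => by
      have := (aux_psd P Q hP hQ hc c hcpos hPQ j k).mul_mul_conjTranspose_same Q
      rw [hQ.1.eq] at this
      have e : P ^ j * Q ^ (k + 2) = Q * (P ^ j * Q ^ k) * Q := by
        rw [← mul_assoc Q, ← (hc.pow_left j).eq, pow_succ, pow_succ']
        simp only [mul_assoc]
      rwa [e]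

/-- The matrix Bernstein polynomial
`B^f_d(M) = ∑_{j=0}^d f(a + j(b−a)/d)·C(d,j)·(M − aI)^j (bI − M)^{d−j}/(b−a)^d`
of a function `f` with `0 ≤ f ≤ 1` on `[a,b]`, evaluated at a symmetric matrix `M` with
`aI ⪯ M ⪯ bI`, satisfies `0 ⪯ B^f_d(M) ⪯ I`. -/
theorem matrix_bernstein_psd_and_bounded {n : ℕ} (a b : ℝ) (hab : a < b)
    (d : ℕ) (hd : 1 ≤ d)
    (M : Matrix (Fin n) (Fin n) ℝ) (hM : M.IsSymm)
    (hMa : (M - a • (1 : Matrix (Fin n) (Fin n) ℝ)).PosSemidef)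
    (hMb : (b • (1 : Matrix (Fin n) (Fin n) ℝ) - M).PosSemidef)
    (f : ℝ → ℝ) (hf : ∀ x ∈ Set.Icc a b, 0 ≤ f x ∧ f x ≤ 1) :
    (∑ j ∈ Finset.range (d + 1),
        (f (a + (j : ℝ) * (b - a) / (d : ℝ)) * (d.choose j : ℝ) / (b - a) ^ d) •
          ((M - a • (1 : Matrix (Fin n) (Fin n) ℝ)) ^ j *
            (b • (1 : Matrix (Fin n) (Fin n) ℝ) - M) ^ (d - j))).PosSemidef ∧
    ((1 : Matrix (Fin n) (Fin n) ℝ) -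
      ∑ j ∈ Finset.range (d + 1),
        (f (a + (j : ℝ) * (b - a) / (d : ℝ)) * (d.choose j : ℝ) / (b - a) ^ d) •
          ((M - a • (1 : Matrix (Fin n) (Fin n) ℝ)) ^ j *
            (b • (1 : Matrix (Fin n) (Fin n) ℝ) - M) ^ (d - j))).PosSemidef := by
  have hba : 0 < b - a := sub_pos.mpr hab
  have hdpos : (0 : ℝ) < d := by exact_mod_cast hd
  have hPQ : (M - a • (1 : Matrix (Fin n) (Fin n) ℝ)) + (b • 1 - M) = (b - a) • 1 := by
    rw [sub_smul]; abel
  have hc : Commute (M - a • (1 : Matrix (Fin n) (Fin n) ℝ)) (b • 1 - M) := by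
    have : (b • (1 : Matrix (Fin n) (Fin n) ℝ) - M) = (b - a) • 1 - (M - a • 1) := by
      rw [← hPQ]; abel
    rw [this]
    exact ((Commute.one_right _).smul_right _).sub_right (Commute.refl _)
  have key := aux_psd _ _ hMa hMb hc (b - a) hba hPQ
  generalize M - a • (1 : Matrix (Fin n) (Fin n) ℝ) = P at *
  generalize b • (1 : Matrix (Fin n) (Fin n) ℝ) - M = Q at *
  have hfj : ∀ j ∈ Finset.range (d + 1), 0 ≤ f (a + (j : ℝ) * (b - a) / (d : ℝ)) ∧
      f (a + (j : ℝ) * (b - a) / (d : ℝ)) ≤ 1 := by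
    intro j hj
    have hjd : (j : ℝ) ≤ d := by exact_mod_cast Nat.lt_succ_iff.mp (Finset.mem_range.mp hj)
    apply hf
    constructor
    · have : 0 ≤ (j : ℝ) * (b - a) / (d : ℝ) := by positivity
      linarith
    · have : (j : ℝ) * (b - a) / (d : ℝ) ≤ b - a := by
        rw [div_le_iff₀ hdpos]; nlinarith
      linarith
  have hone : (1 : Matrix (Fin n) (Fin n) ℝ) = ∑ j ∈ Finset.range (d + 1),
      ((d.choose j : ℝ) / (b - a) ^ d) • (P ^ j * Q ^ (d - j)) := by
    have h1 := hc.add_pow d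
    rw [hPQ, smul_pow, one_pow] at h1
    have h2 : (1 : Matrix (Fin n) (Fin n) ℝ) = ((b - a) ^ d)⁻¹ • ((b - a) ^ d • 1) := by
      rw [smul_smul, inv_mul_cancel₀ (pow_pos hba d).ne', one_smul]
    rw [h2, h1, Finset.smul_sum]
    refine Finset.sum_congr rfl fun j _ => ?_
    rw [← (Nat.cast_commute (d.choose j) (P ^ j * Q ^ (d - j))).eq, ← nsmul_eq_mul,
      ← Nat.cast_smul_eq_nsmul ℝ, smul_smul, div_eq_inv_mul]
  constructor
  · refine Matrix.posSemidef_sum _ fun j hj => (key j (d - j)).smul ?_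
    have := (hfj j hj).1
    positivity
  · rw [hone, ← Finset.sum_sub_distrib]
    refine Matrix.posSemidef_sum _ fun j hj => ?_
    rw [← sub_smul]
    refine (key j (d - j)).smul ?_
    have h1 : 0 ≤ 1 - f (a + (j : ℝ) * (b - a) / (d : ℝ)) := sub_nonneg.mpr (hfj j hj).2
    rw [mul_div_assoc, ← one_sub_mul]
    positivity
end

section
/- Let Σ be a real positive semidefinite n×n matrix and k ≥ 0 an integer. Define the matrix G, with rows and columns indexed by tuples I, J ∈ {1,…,n}^k, by G_{I,J} = ∑_{π ∈ S_k} ∏_{i=1}^{k} Σ_{I_i, J_{π(i)}}, where S_k is the symmetric group on k elements. Then the ℓ²→ℓ² operator norm of G satisfies ‖G‖_op ≤ k! · ‖Σ‖_op^k. -/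
open Matrix

/-- The ℓ²→ℓ² operator (spectral) norm of a real matrix, realized through the
associated linear map between Euclidean spaces. -/
noncomputable def l2OpNorm {ι κ : Type*} [Fintype ι] [Fintype κ] [DecidableEq ι]
    (M : Matrix κ ι ℝ) : ℝ :=
  ‖LinearMap.toContinuousLinearMap (Matrix.toEuclideanLin M)‖

lemma tens_bound {n : ℕ} (S : Matrix (Fin n) (Fin n) ℝ) (c : ℝ)
    (h : ∀ v : Fin n → ℝ, ∑ a, (∑ b, S a b * v b) ^ 2 ≤ c ^ 2 * ∑ b, v b ^ 2) (k : ℕ) :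
    ∀ x : (Fin k → Fin n) → ℝ,
      ∑ I : Fin k → Fin n, (∑ J, (∏ i, S (I i) (J i)) * x J) ^ 2 ≤ (c ^ k) ^ 2 * ∑ J, x J ^ 2 := by
  induction k with
  | zero => intro x; simp
  | succ k ih =>
    intro x
    have e : ∀ f : (Fin (k + 1) → Fin n) → ℝ,
        ∑ I, f I = ∑ a, ∑ I : Fin k → Fin n, f (Fin.cons a I) := by
      intro f
      rw [← (Fin.consEquiv (fun _ : Fin (k + 1) => Fin n)).sum_comp, Fintype.sum_prod_type]
      rfl
    simp only [e, Fin.prod_univ_succ, Fin.cons_zero, Fin.cons_succ]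
    calc ∑ a, ∑ I : Fin k → Fin n,
          (∑ b, ∑ J : Fin k → Fin n, S a b * (∏ i, S (I i) (J i)) * x (Fin.cons b J)) ^ 2
        = ∑ I : Fin k → Fin n, ∑ a, (∑ b, S a b *
            ∑ J : Fin k → Fin n, (∏ i, S (I i) (J i)) * x (Fin.cons b J)) ^ 2 := by
          rw [Finset.sum_comm]
          simp only [Finset.mul_sum, mul_assoc]
      _ ≤ ∑ I : Fin k → Fin n, c ^ 2 * ∑ b,
            (∑ J : Fin k → Fin n, (∏ i, S (I i) (J i)) * x (Fin.cons b J)) ^ 2 :=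
          Finset.sum_le_sum fun I _ => h _
      _ = c ^ 2 * ∑ b, ∑ I : Fin k → Fin n,
            (∑ J : Fin k → Fin n, (∏ i, S (I i) (J i)) * x (Fin.cons b J)) ^ 2 := by
          rw [← Finset.mul_sum, Finset.sum_comm]
      _ ≤ c ^ 2 * ∑ b, (c ^ k) ^ 2 * ∑ J : Fin k → Fin n, x (Fin.cons b J) ^ 2 := by
          gcongr with b
          exact ih _
      _ = _ := by rw [← Finset.mul_sum]; ring

lemma perm_bound {n : ℕ} (S : Matrix (Fin n) (Fin n) ℝ) (c : ℝ)
    (h : ∀ v : Fin n → ℝ, ∑ a, (∑ b, S a b * v b) ^ 2 ≤ c ^ 2 * ∑ b, v b ^ 2) (k : ℕ)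
    (π : Equiv.Perm (Fin k)) (x : (Fin k → Fin n) → ℝ) :
      ∑ I : Fin k → Fin n, (∑ J, (∏ i, S (I i) (J (π i))) * x J) ^ 2 ≤ (c ^ k) ^ 2 * ∑ J, x J ^ 2 := by
  have e : ∀ f : (Fin k → Fin n) → ℝ, ∑ J, f J = ∑ J : Fin k → Fin n, f (J ∘ π.symm) := fun f =>
    ((Equiv.arrowCongr π (Equiv.refl (Fin n))).sum_comp f).symm
  have := tens_bound S c h k (fun J => x (J ∘ π.symm))
  rw [← e (fun J => x J ^ 2)] at this
  convert this using 3 with I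
  rw [e]
  simp

/-- Operator norm bound on the Hermite Gram matrix: for a real PSD matrix `S` and the
matrix `G` indexed by tuples `I, J ∈ {1,…,n}^k` with entries
`G_{I,J} = ∑_{π ∈ S_k} ∏_i S_{I_i, J_{π(i)}}`, one has `‖G‖_op ≤ k!·‖S‖_op^k`. -/
theorem hermite_gram_opnorm_bound {n k : ℕ} (S : Matrix (Fin n) (Fin n) ℝ)
    (hS : S.PosSemidef) :
    l2OpNorm (Matrix.of fun I J : Fin k → Fin n =>
        ∑ π : Equiv.Perm (Fin k), ∏ i, S (I i) (J (π i)))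
      ≤ (Nat.factorial k : ℝ) * l2OpNorm S ^ k := by
  have hc : 0 ≤ l2OpNorm S := norm_nonneg _
  have h : ∀ v : Fin n → ℝ,
      ∑ a, (∑ b, S a b * v b) ^ 2 ≤ (l2OpNorm S) ^ 2 * ∑ b, v b ^ 2 := by
    intro v
    have := (LinearMap.toContinuousLinearMap (Matrix.toEuclideanLin S)).le_opNorm (WithLp.toLp 2 v)
    have := pow_le_pow_left₀ (norm_nonneg _) this 2
    rw [mul_pow, EuclideanSpace.norm_sq_eq, EuclideanSpace.norm_sq_eq] at this
    simpa [Matrix.mulVec, dotProduct, l2OpNorm] using this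
  generalize l2OpNorm S = c at *
  refine ContinuousLinearMap.opNorm_le_bound _ (by positivity) fun x => ?_
  have hx : (LinearMap.toContinuousLinearMap (Matrix.toEuclideanLin
      (Matrix.of fun I J : Fin k → Fin n =>
        ∑ π : Equiv.Perm (Fin k), ∏ i, S (I i) (J (π i))))) x =
      ∑ π : Equiv.Perm (Fin k), (WithLp.toLp 2 (fun I : Fin k → Fin n =>
        ∑ J, (∏ i, S (I i) (J (π i))) * x J) : EuclideanSpace ℝ (Fin k → Fin n)) := by
    ext I
    simp [Matrix.mulVec, dotProduct, Finset.sum_mul]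
    rw [Finset.sum_comm]
  rw [hx]
  calc _ ≤ ∑ π : Equiv.Perm (Fin k), c ^ k * ‖x‖ := by
        refine norm_sum_le_of_le _ fun π _ => ?_
        refine (sq_le_sq₀ (norm_nonneg _) (by positivity)).1 ?_
        rw [mul_pow, EuclideanSpace.norm_sq_eq, EuclideanSpace.norm_sq_eq]
        simpa using perm_bound S c h k π x
    _ = _ := by simp [Fintype.card_perm, mul_assoc]
end
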